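/- Let {T̃_M} and {K̃_M}, with T̃_M, K̃_M ∈ End(V^{⊗M})⊗R, be families indexed by ordered label sets such that every matrix entry of every T̃_M commutes in R with every matrix entry of every K̃_M. Assume for all disjoint ordered label sets M, N′: (i) the DKM-type fused exchange relation A_{M̄N′} T̃_M B_{MN̄′} T̃_{N′} = T̃_{N′} C_{M̄N′} T̃_M D_{MN̄′}, and (ii) the DKM-type fused dual exchange relation (A_{M̄N′}⁻¹)^{t_M t_{N′}} K̃_M ((B_{MN̄′}^{t_M})⁻¹)^{t_{N′}} K̃_{N′} = K̃_{N′} ((C_{M̄N′}^{t_{N′}})⁻¹)^{t_M} K̃_M (D_{MN̄′}^{t_M t_{N′}})⁻¹, where the scalar matrices A_{M̄N′}, D_{MN̄′}, B_{MN̄′}^{t_M}, C_{M̄N′}^{t_{N′}} are invertible. Then the elements H̃_M := Tr_{V^{⊗M}}(K̃_M^{t_M} T̃_M) ∈ R mutually commute: H̃_M H̃_{N′} = H̃_{N′} H̃_M for all disjoint ordered label sets M, N′. -/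

import Mathlib

open Matrix

namespace QT

variable {n : ℕ} {ι : Type*} [Fintype ι] [DecidableEq ι] {α : Type*}
variable {R : Type*} [Ring R] [Algebra ℂ R]

/-- Operators on `V^{⊗ι}`, `V = ℂⁿ`, with entries in `α`. -/
abbrev Tens (ι : Type*) (n : ℕ) (α : Type*) := Matrix (ι → Fin n) (ι → Fin n) α

/-- Two-site matrices, i.e. elements of `End(V ⊗ V)` with entries in `α`. -/
abbrev M2 (n : ℕ) (α : Type*) := Matrix (Fin n × Fin n) (Fin n × Fin n) α

/-- `X_{ij}` : embedding of a two-site matrix at the (distinct) sites `i, j`,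
acting as the identity elsewhere. -/
noncomputable def emb2 [MulZeroOneClass α] (X : M2 n α) (i j : ι) : Tens ι n α :=
  Matrix.of fun f g =>
    if ∀ k, k ≠ i → k ≠ j → f k = g k then X (f i, f j) (g i, g j) else 0

/-- `T_i` : embedding of a one-site matrix at site `i`. -/
noncomputable def emb1 [Zero α] (T : Matrix (Fin n) (Fin n) α) (i : ι) : Tens ι n α :=
  Matrix.of fun f g => if ∀ k, k ≠ i → f k = g k then T (f i) (g i) else 0

/-- Fused matrix `X_{MN} = ∏→_{i∈M} ∏→_{j∈N} X_{ij}` (a bar, i.e. reversal of one of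
the ordered label sets, is obtained by passing `M.reverse` or `N.reverse`). -/
noncomputable def fuse [Semiring α] (X : M2 n α) (M N : List ι) : Tens ι n α :=
  (M.map fun i => (N.map fun j => emb2 X i j).prod).prod

/-- Partial transposition `t_S` in the factors labelled by `S`. -/
noncomputable def ptrans (S : Finset ι) (X : Tens ι n α) : Tens ι n α :=
  Matrix.of fun f g =>
    X (fun k => if k ∈ S then g k else f k) (fun k => if k ∈ S then f k else g k)

/-- Partial transposition `t₁` on a two-site matrix. -/
noncomputable def t1 (X : M2 n α) : M2 n α :=
  Matrix.of fun p q => X (q.1, p.2) (p.1, q.2)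

/-- Partial transposition `t₂` on a two-site matrix. -/
noncomputable def t2 (X : M2 n α) : M2 n α :=
  Matrix.of fun p q => X (p.1, q.2) (q.1, p.2)

/-- `X₂₁ = P X₁₂ P` : permutation of the two factors of a two-site matrix. -/
noncomputable def perm2 (X : M2 n α) : M2 n α :=
  Matrix.of fun p q => X (p.2, p.1) (q.2, q.1)

/-- The permutation (flip) matrix `P` on `V ⊗ V`. -/
noncomputable def PM (n : ℕ) (α : Type*) [Zero α] [One α] : M2 n α :=
  Matrix.of fun p q => if p.1 = q.2 ∧ p.2 = q.1 then 1 else 0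

/-- Index type for `V^{⊗M}`. -/
abbrev idx (n : ℕ) {ι : Type*} [DecidableEq ι] (M : List ι) :=
  {x // x ∈ M.toFinset} → Fin n

/-- Embedding `End(V^{⊗M}) ⊗ R → End(V^{⊗ι}) ⊗ R`, acting as the identity off `M`. -/
noncomputable def embS [Zero α] (M : List ι) (X : Matrix (idx n M) (idx n M) α) :
    Tens ι n α :=
  Matrix.of fun f g =>
    if ∀ k, k ∉ M.toFinset → f k = g k then
      X (fun i => f i.1) (fun i => g i.1) else 0

/-- A pair of disjoint ordered label sets. -/
def OkPair (M N : List ι) : Prop := M.Nodup ∧ N.Nodup ∧ M.Disjoint N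

/-- Fused solution `T_M = ∏→_{i∈M} ( T_i ∏→_{j∈M, j>i} B_{ij} )` of the quadratic
exchange algebra (also used for the dual fusion, with `B` replaced by the
appropriate dual structure matrix). -/
noncomputable def fuseT (B : M2 n ℂ) (T : Matrix (Fin n) (Fin n) R) :
    List ι → Tens ι n R
  | [] => 1
  | i :: M => emb1 T i *
      ((M.map fun j => (emb2 B i j).map (algebraMap ℂ R)).prod) * fuseT B T M

/-- The chain `X̌_{i₁i₂} X̌_{i₂i₃} ⋯ X̌_{i_{m-1}i_m}` along the ordered label set,
where `X̌_{ij} = P_{ij} X_{ij}`. -/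
noncomputable def chainCheck (X : M2 n ℂ) : List ι → Tens ι n ℂ
  | [] => 1
  | [_] => 1
  | i :: j :: M => emb2 (PM n ℂ * X) i j * chainCheck X (j :: M)

/-- The lexicographically ordered product `L_M = ∏_{i<j ∈ M} A_{ij}`. -/
noncomputable def lexA (A : M2 n ℂ) : List ι → Tens ι n ℂ
  | [] => 1
  | i :: M => (M.map fun j => emb2 A i j).prod * lexA A M

/-- DKM-type fused solution
`T̃_M = ∏→_{i∈M} ( (∏→_{j>i} A_{ij}) T_i (∏←_{j>i} B_{ij}) )`. -/
noncomputable def fuseT2 (A B : M2 n ℂ) (T : Matrix (Fin n) (Fin n) R) :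
    List ι → Tens ι n R
  | [] => 1
  | i :: M => ((M.map fun j => emb2 A i j).prod).map (algebraMap ℂ R) * emb1 T i *
      ((M.reverse.map fun j => emb2 B i j).prod).map (algebraMap ℂ R) * fuseT2 A B T M

/-! ### Dynamical setting -/

/-- the space of dynamical parameters `λ ∈ ℂⁿ`. -/
abbrev Lam (n : ℕ) := Fin n → ℂ

/-- standard basis vector `e_a` of `ℂⁿ`. -/
noncomputable def ee {n : ℕ} (a : Fin n) : Lam n := Pi.single a 1

/-- `Σ_{k∈S} e_{f k}` : the dynamical shift read off the indices at the factors in `S`. -/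
noncomputable def shL (S : Finset ι) (f : ι → Fin n) : Lam n := ∑ k ∈ S, ee (f k)

/-- The dynamical shift `X(λ + h_S)` of a matrix-valued function of `λ` (which is
assumed to act as the identity on the factors labelled by `S`). -/
noncomputable def dsh (S : Finset ι) (X : Lam n → Tens ι n α) : Lam n → Tens ι n α :=
  fun lam => Matrix.of fun f g => X (lam + shL S f) f g

/-- Dynamical structure matrices `ℂⁿ → End(V⊗V)`. -/
abbrev DSM (n : ℕ) := Lam n → M2 n ℂ

/-- Fused `A_{MN̄′}` (no dynamical shifts occur in the recursion for `A`). -/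
noncomputable def fuseAd (A : DSM n) (M N : List ι) : Lam n → Tens ι n ℂ :=
  fun lam => fuse (A lam) M N.reverse

/-- Fused `B_{MN′} = B_{1N′} ⋅ B_{M₀N′}(λ+h₁)`. -/
noncomputable def fuseBd (B : DSM n) : List ι → List ι → Lam n → Tens ι n ℂ
  | [], _ => fun _ => 1
  | i :: M, N => fun lam =>
      ((N.map fun j => emb2 (B lam) i j).prod) * dsh {i} (fuseBd B M N) lam

/-- Fused `C_{MN′} = C_{M1′} ⋅ C_{MN′₀}(λ+h_{1′})`. -/
noncomputable def fuseCd (C : DSM n) : List ι → List ι → Lam n → Tens ι n ℂ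
  | _, [] => fun _ => 1
  | M, j :: N => fun lam =>
      ((M.map fun i => emb2 (C lam) i j).prod) * dsh {j} (fuseCd C M N) lam

/-- Fused `D_{iN̄′} = D_{in′}(λ+h_{(1′,n′-1)}) ⋅ D_{i,(N̄′)₀}` (`Nr` is the reversed `N′`). -/
noncomputable def fuseD1 (D : DSM n) (i : ι) : List ι → Lam n → Tens ι n ℂ
  | [] => fun _ => 1
  | j :: Nr => fun lam =>
      dsh Nr.toFinset (fun mu => emb2 (D mu) i j) lam * fuseD1 D i Nr lam

/-- Fused `D_{MN̄′} = D_{1N̄′} ⋅ D_{M₀N̄′}(λ+h₁)`. -/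
noncomputable def fuseDd (D : DSM n) : List ι → List ι → Lam n → Tens ι n ℂ
  | [], _ => fun _ => 1
  | i :: M, N => fun lam => fuseD1 D i N.reverse lam * dsh {i} (fuseDd D M N) lam

/-- zero-weight condition on the first factor: `[B₁₂, h⊗1] = 0` for all diagonal `h`. -/
def WB (B : DSM n) : Prop := ∀ lam (d : Fin n → ℂ),
  B lam * Matrix.diagonal (fun p => d p.1) = Matrix.diagonal (fun p => d p.1) * B lam

/-- zero-weight condition on the second factor: `[C₁₂, 1⊗h] = 0` for all diagonal `h`. -/
def WC (C : DSM n) : Prop := ∀ lam (d : Fin n → ℂ),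
  C lam * Matrix.diagonal (fun p => d p.2) = Matrix.diagonal (fun p => d p.2) * C lam

/-- total zero-weight condition: `[D₁₂, h⊗1 + 1⊗h] = 0` for all diagonal `h`. -/
def WD (D : DSM n) : Prop := ∀ lam (d : Fin n → ℂ),
  D lam * Matrix.diagonal (fun p => d p.1 + d p.2)
    = Matrix.diagonal (fun p => d p.1 + d p.2) * D lam

/-- The four coupled semi-dynamical Yang–Baxter equations, on `V⊗V⊗V`. -/
def SDYB (A B C D : DSM n) : Prop :=
  (∀ lam, emb2 (ι := Fin 3) (A lam) 0 1 * emb2 (A lam) 0 2 * emb2 (A lam) 1 2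
      = emb2 (A lam) 1 2 * emb2 (A lam) 0 2 * emb2 (A lam) 0 1) ∧
  (∀ lam, dsh {2} (fun mu => emb2 (ι := Fin 3) (D mu) 0 1) lam * emb2 (D lam) 0 2 *
        dsh {0} (fun mu => emb2 (D mu) 1 2) lam
      = emb2 (D lam) 1 2 * dsh {1} (fun mu => emb2 (D mu) 0 2) lam * emb2 (D lam) 0 1) ∧
  (∀ lam, emb2 (ι := Fin 3) (D lam) 0 1 * emb2 (B lam) 0 2 *
        dsh {0} (fun mu => emb2 (B mu) 1 2) lam
      = emb2 (B lam) 1 2 * dsh {1} (fun mu => emb2 (B mu) 0 2) lam * emb2 (D lam) 0 1) ∧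
  (∀ lam, emb2 (ι := Fin 3) (A lam) 0 1 * emb2 (C lam) 0 2 * emb2 (C lam) 1 2
      = emb2 (C lam) 1 2 * emb2 (C lam) 0 2 * dsh {2} (fun mu => emb2 (A mu) 0 1) lam)

/-- Fused semi-dynamical solution
`T_M(λ) = ∏→_{i∈M} ( T_i(λ + h_{{k∈M : k<i}}) ∏→_{j∈M, j>i} B_{ij}(λ) )`. -/
noncomputable def fuseTd (B : DSM n) (T : Lam n → Matrix (Fin n) (Fin n) R)
    (M : List ι) : Lam n → Tens ι n R := fun lam =>
  (M.map fun i =>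
    dsh ((M.takeWhile (fun k => decide (k ≠ i))).toFinset)
        (fun mu => emb1 (T mu) i) lam *
    ((((M.dropWhile (fun k => decide (k ≠ i))).tail).map fun j =>
        emb2 (B lam) i j).prod).map (algebraMap ℂ R)).prod



section Pairing

variable {I J R : Type*} [Fintype I] [DecidableEq I] [Fintype J] [DecidableEq J]
  [Ring R] [Algebra ℂ R]

/-- `X ⊗ 1` on a product index type. -/
def leftFactor {α : Type*} [Zero α] (J : Type*) [DecidableEq J] (X : Matrix I I α) :
    Matrix (I × J) (I × J) α :=
  Matrix.of fun p q => if p.2 = q.2 then X p.1 q.1 else 0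

/-- `1 ⊗ X` on a product index type. -/
def rightFactor {α : Type*} [Zero α] (I : Type*) [DecidableEq I] (X : Matrix J J α) :
    Matrix (I × J) (I × J) α :=
  Matrix.of fun p q => if p.1 = q.1 then X p.2 q.2 else 0

/-- The pairing `∑ Y_{pq} X_{pq} = Tr (Yᵗ X)`. -/
def entryPairing {P : Type*} [Fintype P] (Y X : Matrix P P R) : R :=
  ∑ p, ∑ q, Y p q * X p q

theorem entryPairing_scalar_mul_right {P : Type*} [Fintype P] (s : Matrix P P ℂ)
    (Y X : Matrix P P R) :
    entryPairing Y (s.map (algebraMap ℂ R) * X)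
      = entryPairing ((sᵀ).map (algebraMap ℂ R) * Y) X := by
  simp only [entryPairing, Matrix.mul_apply, Matrix.map_apply, Matrix.transpose_apply,
    Finset.mul_sum, Finset.sum_mul]
  rw [Finset.sum_congr rfl fun p _ => Finset.sum_comm, Finset.sum_comm]
  refine Finset.sum_congr rfl fun p _ => ?_
  rw [Finset.sum_comm]
  refine Finset.sum_congr rfl fun q _ => Finset.sum_congr rfl fun r _ => ?_
  rw [← mul_assoc, ← Algebra.commutes]

theorem entryPairing_mul_scalar_right {P : Type*} [Fintype P] (s : Matrix P P ℂ)
    (Y X : Matrix P P R) :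
    entryPairing Y (X * s.map (algebraMap ℂ R))
      = entryPairing (Y * (sᵀ).map (algebraMap ℂ R)) X := by
  simp only [entryPairing, Matrix.mul_apply, Matrix.map_apply, Matrix.transpose_apply,
    Finset.mul_sum, Finset.sum_mul]
  refine Finset.sum_congr rfl fun p _ => ?_
  rw [Finset.sum_comm]
  refine Finset.sum_congr rfl fun q _ => Finset.sum_congr rfl fun r _ => ?_
  rw [mul_assoc, Algebra.commutes]

theorem leftFactor_mul_mul_rightFactor_apply (S : Matrix (I × J) (I × J) ℂ)
    (X : Matrix I I R) (Y : Matrix J J R) (a c : I) (b d : J) :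
    (leftFactor J X * S.map (algebraMap ℂ R) * rightFactor I Y) (a, b) (c, d)
      = ∑ e, ∑ f, S (e, b) (c, f) • (X a e * Y f d) := by
  simp only [Matrix.mul_apply, leftFactor, rightFactor, Matrix.of_apply, Matrix.map_apply,
    Fintype.sum_prod_type, ite_mul, mul_ite, zero_mul, mul_zero, Finset.sum_ite_eq,
    Finset.sum_ite_eq', Finset.mem_univ, if_true, Finset.sum_mul, Finset.sum_ite_irrel,
    Finset.sum_const_zero]
  rw [Finset.sum_comm]
  refine Finset.sum_congr rfl fun e _ => Finset.sum_congr rfl fun f _ => ?_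
  rw [← Algebra.commutes, mul_assoc, Algebra.smul_def]

theorem rightFactor_mul_mul_leftFactor_apply (S : Matrix (I × J) (I × J) ℂ)
    (X : Matrix I I R) (Y : Matrix J J R) (a c : I) (b d : J) :
    (rightFactor I Y * S.map (algebraMap ℂ R) * leftFactor J X) (a, b) (c, d)
      = ∑ f, ∑ e, S (a, f) (e, d) • (Y b f * X e c) := by
  simp only [Matrix.mul_apply, leftFactor, rightFactor, Matrix.of_apply, Matrix.map_apply,
    Fintype.sum_prod_type, ite_mul, mul_ite, zero_mul, mul_zero, Finset.sum_ite_eq,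
    Finset.sum_ite_eq', Finset.mem_univ, if_true, Finset.sum_mul, Finset.sum_ite_irrel,
    Finset.sum_const_zero]
  rw [Finset.sum_comm]
  refine Finset.sum_congr rfl fun e _ => Finset.sum_congr rfl fun f _ => ?_
  rw [← Algebra.commutes, mul_assoc, Algebra.smul_def]

omit [Algebra ℂ R] in
theorem trace_transpose_mul_eq_sum {P : Type*} [Fintype P] (K T : Matrix P P R) :
    Matrix.trace (Kᵀ * T) = ∑ p, ∑ q, K p q * T p q := by
  simp only [Matrix.trace, Matrix.diag, Matrix.mul_apply, Matrix.transpose_apply]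
  exact Finset.sum_comm

/-- Contracting two sandwiches whose middle matrices are dual to each other. -/
theorem sum_sandwich_eq_trace_mul_trace
    (T₁ K₁ : Matrix I I R) (T₂ K₂ : Matrix J J R)
    (hcomm : ∀ a b c d, Commute (T₁ a b) (K₂ c d))
    (w v : I → J → I → J → ℂ)
    (hdual : ∀ e f e' f', ∑ b, ∑ c, w e b c f * v e' b c f'
      = if e = e' ∧ f = f' then 1 else 0) :
    ∑ a, ∑ d, ∑ b, ∑ c,
      (∑ e, ∑ f, w e b c f • (K₁ a e * K₂ f d)) *
        (∑ e, ∑ f, v e b c f • (T₁ a e * T₂ f d))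
      = Matrix.trace (K₁ᵀ * T₁) * Matrix.trace (K₂ᵀ * T₂) := by
  have key : ∀ a d, ∑ b, ∑ c,
      (∑ e, ∑ f, w e b c f • (K₁ a e * K₂ f d)) *
        (∑ e, ∑ f, v e b c f • (T₁ a e * T₂ f d))
      = ∑ e, ∑ f, (K₁ a e * T₁ a e) * (K₂ f d * T₂ f d) := by
    intro a d
    calc _ = ∑ b, ∑ c, ∑ x : I × J, ∑ y : I × J,
          (w x.1 b c x.2 * v y.1 b c y.2) •
            ((K₁ a x.1 * K₂ x.2 d) * (T₁ a y.1 * T₂ y.2 d)) := by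
          refine Finset.sum_congr rfl fun b _ => Finset.sum_congr rfl fun c _ => ?_
          rw [← Fintype.sum_prod_type' fun e f => w e b c f • (K₁ a e * K₂ f d),
            ← Fintype.sum_prod_type' fun e f => v e b c f • (T₁ a e * T₂ f d),
            Finset.sum_mul_sum]
          refine Finset.sum_congr rfl fun x _ => Finset.sum_congr rfl fun y _ => ?_
          rw [smul_mul_smul_comm]
      _ = ∑ x : I × J, ∑ y : I × J, (∑ b, ∑ c, w x.1 b c x.2 * v y.1 b c y.2) •
            ((K₁ a x.1 * K₂ x.2 d) * (T₁ a y.1 * T₂ y.2 d)) := by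
          simp only [Finset.sum_smul]
          rw [Finset.sum_congr rfl fun b _ => Finset.sum_comm, Finset.sum_comm]
          refine Finset.sum_congr rfl fun x _ => ?_
          rw [Finset.sum_congr rfl fun b _ => Finset.sum_comm, Finset.sum_comm]
      _ = ∑ x : I × J, (K₁ a x.1 * K₂ x.2 d) * (T₁ a x.1 * T₂ x.2 d) := by
          refine Finset.sum_congr rfl fun x _ => ?_
          simp only [hdual, ← Prod.ext_iff, ite_smul, one_smul, zero_smul,
            Finset.sum_ite_eq, Finset.mem_univ, if_true]
      _ = _ := by
          rw [Fintype.sum_prod_type]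
          refine Finset.sum_congr rfl fun e _ => Finset.sum_congr rfl fun f _ => ?_
          rw [mul_assoc, ← mul_assoc (K₂ f d), ← (hcomm a e f d).eq, mul_assoc, mul_assoc]
  simp only [key, trace_transpose_mul_eq_sum]
  rw [Finset.sum_comm (f := fun p q => K₂ p q * T₂ p q), Finset.sum_mul_sum]
  simp only [Finset.sum_mul_sum]

theorem entryPairing_left_right
    (T₁ K₁ : Matrix I I R) (T₂ K₂ : Matrix J J R)
    (hcomm : ∀ a b c d, Commute (T₁ a b) (K₂ c d))
    (W S : Matrix (I × J) (I × J) ℂ)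
    (hdual : ∀ e f e' f', ∑ b, ∑ c, W (e, b) (c, f) * S (e', b) (c, f')
      = if e = e' ∧ f = f' then 1 else 0) :
    entryPairing (leftFactor J K₁ * W.map (algebraMap ℂ R) * rightFactor I K₂)
        (leftFactor J T₁ * S.map (algebraMap ℂ R) * rightFactor I T₂)
      = Matrix.trace (K₁ᵀ * T₁) * Matrix.trace (K₂ᵀ * T₂) := by
  rw [← sum_sandwich_eq_trace_mul_trace T₁ K₁ T₂ K₂ hcomm
    (fun e b c f => W (e, b) (c, f)) (fun e b c f => S (e, b) (c, f)) hdual]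
  simp only [entryPairing, Fintype.sum_prod_type, leftFactor_mul_mul_rightFactor_apply]
  refine Finset.sum_congr rfl fun a _ => ?_
  rw [Finset.sum_congr rfl fun b _ => Finset.sum_comm, Finset.sum_comm]

theorem entryPairing_right_left
    (T₁ K₁ : Matrix I I R) (T₂ K₂ : Matrix J J R)
    (hcomm : ∀ a b c d, Commute (T₂ a b) (K₁ c d))
    (W S : Matrix (I × J) (I × J) ℂ)
    (hdual : ∀ f e f' e', ∑ a, ∑ d, W (a, f) (e, d) * S (a, f') (e', d)
      = if f = f' ∧ e = e' then 1 else 0) :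
    entryPairing (rightFactor I K₂ * W.map (algebraMap ℂ R) * leftFactor J K₁)
        (rightFactor I T₂ * S.map (algebraMap ℂ R) * leftFactor J T₁)
      = Matrix.trace (K₂ᵀ * T₂) * Matrix.trace (K₁ᵀ * T₁) := by
  rw [← sum_sandwich_eq_trace_mul_trace T₂ K₂ T₁ K₁ hcomm
    (fun f a d e => W (a, f) (e, d)) (fun f a d e => S (a, f) (e, d)) hdual]
  simp only [entryPairing, Fintype.sum_prod_type, rightFactor_mul_mul_leftFactor_apply]
  rw [Finset.sum_comm]
  refine Finset.sum_congr rfl fun b _ => ?_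
  rw [Finset.sum_comm]

/-- Commuting traces for a pair of quadratic exchange relations on a tensor product of two
spaces. -/
theorem trace_mul_trace_comm_of_exchange
    (T₁ K₁ : Matrix I I R) (T₂ K₂ : Matrix J J R)
    (h₁₂ : ∀ a b c d, Commute (T₁ a b) (K₂ c d))
    (h₂₁ : ∀ a b c d, Commute (T₂ a b) (K₁ c d))
    (A A' B B' C C' D D' : Matrix (I × J) (I × J) ℂ)
    (hA : A' * A = 1) (hD : D * D' = 1)
    (hB : ∀ e f e' f', ∑ b, ∑ c, B' (e, b) (c, f) * B (e', b) (c, f')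
      = if e = e' ∧ f = f' then 1 else 0)
    (hC : ∀ f e f' e', ∑ a, ∑ d, C' (a, f) (e, d) * C (a, f') (e', d)
      = if f = f' ∧ e = e' then 1 else 0)
    (hT : A.map (algebraMap ℂ R) * leftFactor J T₁ * B.map (algebraMap ℂ R) * rightFactor I T₂
      = rightFactor I T₂ * C.map (algebraMap ℂ R) * leftFactor J T₁ * D.map (algebraMap ℂ R))
    (hK : A'ᵀ.map (algebraMap ℂ R) * leftFactor J K₁ * B'.map (algebraMap ℂ R) *
        rightFactor I K₂
      = rightFactor I K₂ * C'.map (algebraMap ℂ R) * leftFactor J K₁ *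
        D'ᵀ.map (algebraMap ℂ R)) :
    Matrix.trace (K₁ᵀ * T₁) * Matrix.trace (K₂ᵀ * T₂)
      = Matrix.trace (K₂ᵀ * T₂) * Matrix.trace (K₁ᵀ * T₁) := by
  have map_one' : (1 : Matrix (I × J) (I × J) ℂ).map (algebraMap ℂ R) = 1 :=
    Matrix.map_one _ (map_zero _) (map_one _)
  rw [← entryPairing_left_right T₁ K₁ T₂ K₂ h₁₂ B' B hB,
    ← entryPairing_right_left T₁ K₁ T₂ K₂ h₂₁ C' C hC]
  set X := leftFactor J T₁ * B.map (algebraMap ℂ R) * rightFactor I T₂ with hX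
  set Y := leftFactor J K₁ * B'.map (algebraMap ℂ R) * rightFactor I K₂ with hY
  set X' := rightFactor I T₂ * C.map (algebraMap ℂ R) * leftFactor J T₁ with hX'
  set Y' := rightFactor I K₂ * C'.map (algebraMap ℂ R) * leftFactor J K₁ with hY'
  have hT' : A.map (algebraMap ℂ R) * X = X' * D.map (algebraMap ℂ R) := by
    rw [← hT, hX]; simp only [Matrix.mul_assoc]
  have hK' : A'ᵀ.map (algebraMap ℂ R) * Y = Y' * D'ᵀ.map (algebraMap ℂ R) := by
    rw [← hK, hY]; simp only [Matrix.mul_assoc]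
  calc entryPairing Y X
      = entryPairing Y (A'.map (algebraMap ℂ R) * (A.map (algebraMap ℂ R) * X)) := by
        rw [← Matrix.mul_assoc, ← Matrix.map_mul, hA, map_one', Matrix.one_mul]
    _ = entryPairing Y' (X' * D.map (algebraMap ℂ R) * D'.map (algebraMap ℂ R)) := by
        rw [entryPairing_scalar_mul_right, hT', hK', ← entryPairing_mul_scalar_right]
    _ = entryPairing Y' X' := by
        rw [Matrix.mul_assoc, ← Matrix.map_mul, hD, map_one', Matrix.mul_one]

end Pairing

section Restriction

/-- `X` acts diagonally on the factors outside `S`. -/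
def DiagonalOff [Zero α] (S : Finset ι) (X : Tens ι n α) : Prop :=
  ∀ f g, ∀ k ∉ S, f k ≠ g k → X f g = 0

omit [Fintype ι] in
theorem DiagonalOff.ptrans [Zero α] {S : Finset ι} {X : Tens ι n α} (hX : DiagonalOff S X)
    {U : Finset ι} (hU : U ⊆ S) : DiagonalOff S (ptrans U X) := by
  intro f g k hk hfg
  have hkU : k ∉ U := fun h => hk (hU h)
  exact hX _ _ k hk (by simpa [hkU] using hfg)

omit [Fintype ι] in
theorem DiagonalOff.ptrans_ptrans [Zero α] {U W : Finset ι} {X : Tens ι n α}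
    (hX : DiagonalOff (U ∪ W) X) (hd : Disjoint U W) : QT.ptrans W (QT.ptrans U X) = Xᵀ := by
  ext f g
  rw [Matrix.transpose_apply]
  by_cases h : ∀ k ∉ U ∪ W, g k = f k
  · simp only [QT.ptrans, Matrix.of_apply]
    congr 1 <;> funext k <;> have hk := h k <;>
      have hUW := fun hU : k ∈ U => Finset.disjoint_left.1 hd hU <;>
      by_cases hU : k ∈ U <;> by_cases hW : k ∈ W <;> simp_all
  · push Not at h
    obtain ⟨k, hk, hne⟩ := h
    rw [hX g f k hk hne]
    exact (hX.ptrans Finset.subset_union_left).ptrans Finset.subset_union_right f g k hk hne.symm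

omit [Fintype ι] [DecidableEq ι] in
theorem DiagonalOff.map {β : Type*} [Zero α] [Zero β] {S : Finset ι} {X : Tens ι n α}
    (hX : DiagonalOff S X) (φ : α → β) (hφ : φ 0 = 0) : DiagonalOff S (X.map φ) := by
  intro f g k hk hfg
  rw [Matrix.map_apply, hX f g k hk hfg, hφ]

theorem diagonalOff_embS [Zero α] {M : List ι} {S : Finset ι} (hM : M.toFinset ⊆ S)
    (X : Matrix (idx n M) (idx n M) α) : DiagonalOff S (embS M X) := by
  intro f g k hk hfg
  rw [embS, Matrix.of_apply, if_neg]
  exact fun h => hfg (h k fun hkM => hk (hM hkM))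

theorem diagonalOff_emb2 [MulZeroOneClass α] {S : Finset ι} {i j : ι} (hi : i ∈ S)
    (hj : j ∈ S) (X : M2 n α) : DiagonalOff S (emb2 X i j) := by
  intro f g k hk hfg
  rw [emb2, Matrix.of_apply, if_neg]
  exact fun h => hfg (h k (fun e => hk (e ▸ hi)) (fun e => hk (e ▸ hj)))

omit [DecidableEq ι] in
theorem diagonalOff_one [Semiring α] (S : Finset ι) : DiagonalOff S (1 : Tens ι n α) := by
  intro f g k _ hfg
  exact Matrix.one_apply_ne fun h => hfg (congrFun h k)

theorem DiagonalOff.mul [Semiring α] {S : Finset ι} {X Y : Tens ι n α}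
    (hX : DiagonalOff S X) (hY : DiagonalOff S Y) : DiagonalOff S (X * Y) := by
  intro f g k hk hfg
  rw [Matrix.mul_apply]
  refine Finset.sum_eq_zero fun h _ => ?_
  by_cases hfh : f k = h k
  · rw [hY h g k hk (hfh ▸ hfg), mul_zero]
  · rw [hX f h k hk hfh, zero_mul]

theorem diagonalOff_list_prod [Semiring α] {S : Finset ι} {l : List (Tens ι n α)}
    (hl : ∀ X ∈ l, DiagonalOff S X) : DiagonalOff S l.prod := by
  induction l with
  | nil => exact diagonalOff_one S
  | cons X l ih =>
    rw [List.prod_cons]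
    exact (hl X List.mem_cons_self).mul (ih fun Y hY => hl Y (List.mem_cons_of_mem _ hY))

theorem diagonalOff_fuse [Semiring α] {S : Finset ι} {M N : List ι} (hM : ∀ i ∈ M, i ∈ S)
    (hN : ∀ j ∈ N, j ∈ S) (X : M2 n α) : DiagonalOff S (fuse X M N) := by
  refine diagonalOff_list_prod fun Y hY => ?_
  obtain ⟨i, hi, rfl⟩ := List.mem_map.1 hY
  refine diagonalOff_list_prod fun Z hZ => ?_
  obtain ⟨j, hj, rfl⟩ := List.mem_map.1 hZ
  exact diagonalOff_emb2 (hM i hi) (hN j hj) X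

theorem DiagonalOff.inv [CommRing α] {S : Finset ι} {X : Tens ι n α}
    (hX : DiagonalOff S X) (hu : IsUnit X) : DiagonalOff S X⁻¹ := by
  have hdet := (Matrix.isUnit_iff_isUnit_det X).1 hu
  intro f g k hk hfg
  let P : Tens ι n α := Matrix.diagonal fun h => if h k = f k then 1 else 0
  have hP : P * X = X * P := by
    ext a b
    simp only [P, Matrix.diagonal_mul, Matrix.mul_diagonal]
    by_cases hab : a k = b k
    · rw [hab, mul_comm]
    · rw [hX a b k hk hab, mul_zero, zero_mul]
  have hP' : P * X⁻¹ = X⁻¹ * P := by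
    calc P * X⁻¹ = X⁻¹ * X * (P * X⁻¹) := by rw [Matrix.nonsing_inv_mul X hdet, Matrix.one_mul]
      _ = X⁻¹ * (P * X) * X⁻¹ := by rw [hP]; simp only [Matrix.mul_assoc]
      _ = X⁻¹ * P := by
        rw [Matrix.mul_assoc, Matrix.mul_assoc, Matrix.mul_nonsing_inv X hdet, Matrix.mul_one]
  have h := congrFun (congrFun hP' f) g
  simpa [P, Matrix.diagonal_mul, Matrix.mul_diagonal, Ne.symm hfg] using h

/-- Glue configurations on `M` and `N`, using `z` at every other factor. -/
def glue (M N : List ι) (z : Fin n) (p : idx n M × idx n N) : ι → Fin n := fun k =>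
  if hM : k ∈ M.toFinset then p.1 ⟨k, hM⟩
  else if hN : k ∈ N.toFinset then p.2 ⟨k, hN⟩ else z

section Glue

omit [Fintype ι]

variable {M N : List ι} (z : Fin n) (p q : idx n M × idx n N)

theorem glue_of_mem_left {k : ι} (hk : k ∈ M.toFinset) : glue M N z p k = p.1 ⟨k, hk⟩ := by
  simp only [glue, dif_pos hk]

theorem glue_of_mem_right (hd : M.Disjoint N) {k : ι} (hk : k ∈ N.toFinset) :
    glue M N z p k = p.2 ⟨k, hk⟩ := by
  have hkM : k ∉ M.toFinset := fun h => hd (List.mem_toFinset.1 h) (List.mem_toFinset.1 hk)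
  simp only [glue, dif_neg hkM, dif_pos hk]

theorem glue_of_notMem {k : ι} (hk : k ∉ M.toFinset ∪ N.toFinset) : glue M N z p k = z := by
  rw [Finset.mem_union, not_or] at hk
  simp only [glue, dif_neg hk.1, dif_neg hk.2]

theorem glue_restrict (hd : M.Disjoint N) {f : ι → Fin n}
    (hf : ∀ k ∉ M.toFinset ∪ N.toFinset, f k = z) :
    glue M N z (fun i => f i.1, fun j => f j.1) = f := by
  funext k
  by_cases hM : k ∈ M.toFinset
  · rw [glue_of_mem_left z _ hM]
  by_cases hN : k ∈ N.toFinset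
  · rw [glue_of_mem_right z _ hd hN]
  have hk : k ∉ M.toFinset ∪ N.toFinset := by simp [hM, hN] at *
  rw [glue_of_notMem z _ hk, hf k hk]

theorem glue_injective (hd : M.Disjoint N) :
    Function.Injective (glue M N z : idx n M × idx n N → ι → Fin n) := by
  intro p q h
  refine Prod.ext (funext fun i => ?_) (funext fun j => ?_)
  · simpa [glue_of_mem_left z _ i.2] using congrFun h i.1
  · simpa [glue_of_mem_right z _ hd j.2] using congrFun h j.1

end Glue

/-- The block of `X` acting on `V^{⊗M} ⊗ V^{⊗N}` with all other factors in the state `z`. -/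
def block (M N : List ι) (z : Fin n) (X : Tens ι n α) :
    Matrix (idx n M × idx n N) (idx n M × idx n N) α :=
  X.submatrix (glue M N z) (glue M N z)

variable {M N : List ι} {z : Fin n}

theorem block_mul [Semiring α] (hd : M.Disjoint N) {X Y : Tens ι n α}
    (hY : DiagonalOff (M.toFinset ∪ N.toFinset) Y) :
    block M N z (X * Y) = block M N z X * block M N z Y := by
  ext p q
  simp only [block, Matrix.submatrix_apply, Matrix.mul_apply]
  symm
  refine Finset.sum_of_injOn (glue M N z) (glue_injective z hd).injOn (by simp) ?_ (by simp)
  intro g _ hg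
  by_cases h : ∀ k ∉ M.toFinset ∪ N.toFinset, g k = z
  · exact absurd ⟨_, by simp, glue_restrict z hd h⟩ hg
  · push Not at h
    obtain ⟨k, hk, hkz⟩ := h
    rw [hY g _ k hk (by rwa [glue_of_notMem z q hk]), mul_zero]

theorem block_one [Semiring α] (hd : M.Disjoint N) :
    block M N z (1 : Tens ι n α) = 1 :=
  Matrix.submatrix_one _ (glue_injective z hd)

theorem block_embS_left [Zero α] (hd : M.Disjoint N) (X : Matrix (idx n M) (idx n M) α) :
    block M N z (embS M X) = leftFactor (idx n N) X := by
  ext p q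
  simp only [block, embS, leftFactor, Matrix.submatrix_apply, Matrix.of_apply]
  have h : (∀ k, k ∉ M.toFinset → glue M N z p k = glue M N z q k) ↔ p.2 = q.2 := by
    constructor
    · intro h
      funext j
      have := h j.1 fun hj => hd (List.mem_toFinset.1 hj) (List.mem_toFinset.1 j.2)
      simpa [glue_of_mem_right z _ hd j.2] using this
    · intro h k hk
      simp only [glue, dif_neg hk, h]
  simp only [h, glue_of_mem_left z _ (Subtype.prop _)]

theorem block_embS_right [Zero α] (hd : M.Disjoint N) (X : Matrix (idx n N) (idx n N) α) :
    block M N z (embS N X) = rightFactor (idx n M) X := by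
  ext p q
  simp only [block, embS, rightFactor, Matrix.submatrix_apply, Matrix.of_apply]
  have h : (∀ k, k ∉ N.toFinset → glue M N z p k = glue M N z q k) ↔ p.1 = q.1 := by
    constructor
    · intro h
      funext j
      have := h j.1 fun hj => hd (List.mem_toFinset.1 j.2) (List.mem_toFinset.1 hj)
      simpa [glue_of_mem_left z _ j.2] using this
    · intro h k hk
      simp only [glue, dif_neg hk, h]
  simp only [h, glue_of_mem_right z _ hd (Subtype.prop _)]

omit [Fintype ι] in
theorem block_ptrans_left (X : Tens ι n α) (a c : idx n M)
    (b d : idx n N) :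
    block M N z (ptrans M.toFinset X) (a, b) (c, d) = block M N z X (c, b) (a, d) := by
  simp only [block, ptrans, Matrix.submatrix_apply, Matrix.of_apply]
  congr 1 <;> funext k <;> by_cases hk : k ∈ M.toFinset <;> simp only [glue, hk, if_true,
    if_false, dif_pos, dif_neg, not_false_eq_true]

omit [Fintype ι] in
theorem block_ptrans_right (hd : M.Disjoint N) (X : Tens ι n α) (a c : idx n M)
    (b d : idx n N) :
    block M N z (ptrans N.toFinset X) (a, b) (c, d) = block M N z X (a, d) (c, b) := by
  simp only [block, ptrans, Matrix.submatrix_apply, Matrix.of_apply]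
  congr 1 <;> funext k <;> by_cases hk : k ∈ N.toFinset
  · simp only [hk, if_true, glue_of_mem_right z _ hd hk]
  · simp only [glue, hk, if_false, dif_neg, not_false_eq_true]
  · simp only [hk, if_true, glue_of_mem_right z _ hd hk]
  · simp only [glue, hk, if_false, dif_neg, not_false_eq_true]

omit [Fintype ι] in
theorem block_ptrans_ptrans (hd : M.Disjoint N) (X : Tens ι n α) :
    block M N z (ptrans N.toFinset (ptrans M.toFinset X)) = (block M N z X)ᵀ := by
  ext ⟨a, b⟩ ⟨c, d⟩
  rw [block_ptrans_right hd, block_ptrans_left, Matrix.transpose_apply]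

theorem block_inv_mul [CommRing α] (hd : M.Disjoint N) {X : Tens ι n α}
    (hX : DiagonalOff (M.toFinset ∪ N.toFinset) X) (hu : IsUnit X) :
    block M N z X⁻¹ * block M N z X = 1 := by
  rw [← block_mul hd hX, Matrix.nonsing_inv_mul X ((Matrix.isUnit_iff_isUnit_det X).1 hu),
    block_one hd]

end Restriction

/-- commuting quantum traces from the DKM-type fusion. -/
theorem commuting_traces_DKM {n : ℕ} (hn : 1 ≤ n)
    {ι : Type} [Fintype ι] [DecidableEq ι]
    {R : Type*} [Ring R] [Algebra ℂ R]
    (A B C D : M2 n ℂ)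
    (T K : (M : List ι) → Matrix (idx n M) (idx n M) R)
    (hcomm : ∀ (M N : List ι) a b c d, Commute (T M a b) (K N c d))
    (hinv : ∀ M N : List ι, OkPair M N →
      IsUnit (fuse A M.reverse N) ∧ IsUnit (fuse D M N.reverse) ∧
      IsUnit (ptrans M.toFinset (fuse B M N.reverse)) ∧
      IsUnit (ptrans N.toFinset (fuse C M.reverse N)))
    (hT : ∀ M N : List ι, OkPair M N →
      (fuse A M.reverse N).map (algebraMap ℂ R) * embS M (T M) *
        (fuse B M N.reverse).map (algebraMap ℂ R) * embS N (T N)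
      = embS N (T N) * (fuse C M.reverse N).map (algebraMap ℂ R) * embS M (T M) *
        (fuse D M N.reverse).map (algebraMap ℂ R))
    (hK : ∀ M N : List ι, OkPair M N →
      (ptrans N.toFinset (ptrans M.toFinset ((fuse A M.reverse N)⁻¹))).map (algebraMap ℂ R) *
        embS M (K M) *
        (ptrans N.toFinset ((ptrans M.toFinset (fuse B M N.reverse))⁻¹)).map (algebraMap ℂ R) *
        embS N (K N)
      = embS N (K N) *
        (ptrans M.toFinset ((ptrans N.toFinset (fuse C M.reverse N))⁻¹)).map (algebraMap ℂ R) *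
        embS M (K M) *
        ((ptrans N.toFinset (ptrans M.toFinset (fuse D M N.reverse)))⁻¹).map (algebraMap ℂ R)) :
    ∀ M N : List ι, OkPair M N →
      Matrix.trace ((K M)ᵀ * T M) * Matrix.trace ((K N)ᵀ * T N)
        = Matrix.trace ((K N)ᵀ * T N) * Matrix.trace ((K M)ᵀ * T M) := by
  intro M N hMN
  obtain ⟨hA, hD, hB, hC⟩ := hinv M N hMN
  have hd := hMN.2.2
  let z : Fin n := ⟨0, hn⟩
  have hl : M.toFinset ⊆ M.toFinset ∪ N.toFinset := Finset.subset_union_left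
  have hr : N.toFinset ⊆ M.toFinset ∪ N.toFinset := Finset.subset_union_right
  have offA := diagonalOff_fuse (S := M.toFinset ∪ N.toFinset) (M := M.reverse) (N := N)
    (by simp +contextual) (by simp +contextual) A
  have offC := diagonalOff_fuse (S := M.toFinset ∪ N.toFinset) (M := M.reverse) (N := N)
    (by simp +contextual) (by simp +contextual) C
  have offB := diagonalOff_fuse (S := M.toFinset ∪ N.toFinset) (M := M) (N := N.reverse)
    (by simp +contextual) (by simp +contextual) B
  have offD := diagonalOff_fuse (S := M.toFinset ∪ N.toFinset) (M := M) (N := N.reverse)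
    (by simp +contextual) (by simp +contextual) D
  have hTMN := hT M N hMN
  have hKMN := hK M N hMN
  generalize fuse A M.reverse N = A' at *
  generalize fuse B M N.reverse = B' at *
  generalize fuse C M.reverse N = C' at *
  generalize fuse D M N.reverse = D' at *
  have hmap : ∀ {X : Tens ι n ℂ}, DiagonalOff (M.toFinset ∪ N.toFinset) X →
      DiagonalOff (M.toFinset ∪ N.toFinset) (X.map (algebraMap ℂ R)) :=
    fun h => h.map _ (map_zero _)
  have blockMap : ∀ X : Tens ι n ℂ, block M N z (X.map (algebraMap ℂ R))
      = (block M N z X).map (algebraMap ℂ R) := fun _ => rfl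
  have offT1 := diagonalOff_embS hl (T M)
  have offT2 := diagonalOff_embS hr (T N)
  have offK1 := diagonalOff_embS hl (K M)
  have offK2 := diagonalOff_embS hr (K N)
  have offBi := ((offB.ptrans hl).inv hB).ptrans hr
  have offCi := ((offC.ptrans hr).inv hC).ptrans hl
  have unitD : IsUnit (ptrans N.toFinset (ptrans M.toFinset D')) := by
    rw [offD.ptrans_ptrans (List.disjoint_toFinset_iff_disjoint.2 hd)]
    exact (Matrix.isUnit_transpose D').2 hD
  have offDi := ((offD.ptrans hl).ptrans hr).inv unitD
  have hT' := congrArg (block M N z) hTMN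
  have hK' := congrArg (block M N z) hKMN
  simp only [block_mul hd, hmap, offB, offC, offD, offT1, offT2, offK1, offK2, offBi, offCi,
    offDi, blockMap, block_embS_left hd, block_embS_right hd, block_ptrans_ptrans hd] at hT' hK'
  have hBdual := block_inv_mul (z := z) hd (offB.ptrans hl) hB
  have hCdual := block_inv_mul (z := z) hd (offC.ptrans hr) hC
  have hDdual := block_inv_mul (z := z) hd ((offD.ptrans hl).ptrans hr) unitD
  rw [block_ptrans_ptrans hd] at hDdual
  refine trace_mul_trace_comm_of_exchange (T M) (K M) (T N) (K N) (hcomm M N) (hcomm N M)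
    (block M N z A') (block M N z A'⁻¹) (block M N z B') _ (block M N z C') _
    (block M N z D') (block M N z (ptrans N.toFinset (ptrans M.toFinset D'))⁻¹)ᵀ
    (block_inv_mul hd offA hA) ?_ ?_ ?_ hT' hK'
  · rw [← Matrix.transpose_inj, Matrix.transpose_mul, Matrix.transpose_transpose, hDdual,
      Matrix.transpose_one]
  · intro e f e' f'
    have h := congrFun (congrFun hBdual (e, f)) (e', f')
    rw [Matrix.mul_apply, Fintype.sum_prod_type, Finset.sum_comm, Matrix.one_apply] at h
    simpa only [block_ptrans_left, block_ptrans_right hd, Prod.mk.injEq] using h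
  · intro f e f' e'
    have h := congrFun (congrFun hCdual (e, f)) (e', f')
    rw [Matrix.mul_apply, Fintype.sum_prod_type, Matrix.one_apply] at h
    simpa only [block_ptrans_left, block_ptrans_right hd, Prod.mk.injEq,
      and_comm (a := f = f')] using h

end QT
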